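/- For μ_1,…,μ_k ∈ ℂ with 1 ≤ k ≤ n, the set H(μ_1,…,μ_k) := {π_n(μ_1,…,μ_k,λ_1,…,λ_{n-k}) : λ_j ∈ ℂ} is an (n−k)-dimensional complex affine subspace of ℂ^n. -/

import Mathlib

/-- The symmetrization map `π_n : ℂ^n → ℂ^n`, whose `j`-th coordinate is the
`(j+1)`-st elementary symmetric polynomial of the entries. -/
noncomputable def symPoly (n : ℕ) (lam : Fin n → ℂ) : Fin n → ℂ :=
  fun j => ∑ t ∈ Finset.powersetCard ((j : ℕ) + 1) Finset.univ, ∏ i ∈ t, lam i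

/-- The `n`-fold symmetric product `S_n(D) = π_n(D^n)` of a planar set `D`. -/
noncomputable def symProd (n : ℕ) (D : Set ℂ) : Set (Fin n → ℂ) :=
  symPoly n '' {lam | ∀ i, lam i ∈ D}


open Polynomial in
/-- The generating polynomial of the elementary symmetric functions. -/
theorem coeff_prod_one_add (n j : ℕ) (lam : Fin n → ℂ) :
    (∏ i, (1 + C (lam i) * X)).coeff j =
      ∑ t ∈ Finset.powersetCard j Finset.univ, ∏ i ∈ t, lam i := by
  classical
  rw [Finset.prod_one_add, Polynomial.finsetSum_coeff]
  have h : ∀ t : Finset (Fin n), (∏ i ∈ t, (C (lam i) * X)).coeff j =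
      if t.card = j then ∏ i ∈ t, lam i else 0 := by
    intro t
    rw [Finset.prod_mul_distrib, Finset.prod_const, ← map_prod, coeff_C_mul_X_pow]
    simp [eq_comm]
  simp_rw [h]
  rw [← Finset.sum_filter, Finset.powersetCard_eq_filter]

open Polynomial in
/-- Over `ℂ` every polynomial of degree at most `m` with constant term one factors. -/
theorem exists_factor (m : ℕ) : ∀ R : ℂ[X], R.coeff 0 = 1 → R.natDegree ≤ m →
    ∃ lam : Fin m → ℂ, R = ∏ i, (1 + C (lam i) * X) := by
  induction m with
  | zero =>
    intro R h0 hd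
    refine ⟨fun _ => 0, ?_⟩
    rw [eq_C_of_natDegree_le_zero hd, h0]
    simp
  | succ m ih =>
    intro R h0 hd
    by_cases hz : R.natDegree ≤ 0
    · refine ⟨fun _ => 0, ?_⟩
      rw [eq_C_of_natDegree_le_zero hz, h0]
      simp
    · have hdeg : R.degree ≠ 0 := by
        intro h
        exact hz (natDegree_eq_of_degree_eq_some h).le
      obtain ⟨r, hr⟩ := IsAlgClosed.exists_root R hdeg
      obtain ⟨S, hS⟩ := dvd_iff_isRoot.mpr hr
      have hc : -r * S.coeff 0 = 1 := by
        have := h0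
        rw [hS, mul_coeff_zero] at this
        simpa using this
      have hr0 : r ≠ 0 := by
        rintro rfl
        simp at hc
      have hS0 : S ≠ 0 := by
        rintro rfl
        simp at hc
      have hSd : S.natDegree ≤ m := by
        rw [hS, natDegree_mul (X_sub_C_ne_zero r) hS0, natDegree_X_sub_C] at hd
        omega
      obtain ⟨lam, hl⟩ := ih (C (-r) * S) (by simpa using hc)
        ((natDegree_C_mul_le _ _).trans hSd)
      refine ⟨Fin.cons (-r⁻¹) lam, ?_⟩
      rw [Fin.prod_univ_succ]
      simp only [Fin.cons_zero, Fin.cons_succ]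
      rw [← hl, hS, ← mul_assoc]
      congr 1
      have : (C r⁻¹ * C r : ℂ[X]) = 1 := by
        rw [← C_mul, inv_mul_cancel₀ hr0, C_1]
      simp only [C_neg]
      linear_combination (-X) * this

open Polynomial in
/-- The polynomial with coefficients `w` in degrees `1, …, m`. -/
noncomputable def tailPoly (m : ℕ) : (Fin m → ℂ) →ₗ[ℂ] ℂ[X] where
  toFun w := ∑ i, C (w i) * X ^ ((i : ℕ) + 1)
  map_add' v w := by simp [add_mul, Finset.sum_add_distrib]
  map_smul' c w := by simp [Finset.smul_sum, smul_eq_C_mul, mul_assoc]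

open Polynomial in
theorem tailPoly_coeff_zero (m : ℕ) (w : Fin m → ℂ) : (tailPoly m w).coeff 0 = 0 := by
  simp [tailPoly, coeff_X_pow]

open Polynomial in
theorem tailPoly_coeff_succ (m : ℕ) (w : Fin m → ℂ) (i : Fin m) :
    (tailPoly m w).coeff ((i : ℕ) + 1) = w i := by
  simp [tailPoly, coeff_X_pow, Fin.val_inj]

open Polynomial in
theorem tailPoly_natDegree (m : ℕ) (w : Fin m → ℂ) : (tailPoly m w).natDegree ≤ m := by
  change (∑ i, C (w i) * X ^ ((i : ℕ) + 1)).natDegree ≤ m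
  apply natDegree_sum_le_of_forall_le
  intro i _
  exact (natDegree_C_mul_X_pow_le _ _).trans i.2

open Polynomial in
theorem prod_natDegree (m : ℕ) (lam : Fin m → ℂ) :
    (∏ i, (1 + C (lam i) * X)).natDegree ≤ m := by
  refine (natDegree_prod_le _ _).trans ?_
  refine (Finset.sum_le_card_nsmul _ _ 1 ?_).trans (by simp)
  intro i _
  refine (natDegree_add_le _ _).trans ?_
  simpa using (natDegree_C_mul_le (lam i) X).trans natDegree_X_le

open Polynomial in
theorem prod_coeff_zero (m : ℕ) (lam : Fin m → ℂ) :
    (∏ i, (1 + C (lam i) * X)).coeff 0 = 1 := by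
  simp [coeff_prod_one_add]

open Polynomial in
theorem prod_eq_tail (m : ℕ) (lam : Fin m → ℂ) :
    (∏ i, (1 + C (lam i) * X)) = 1 + tailPoly m (symPoly m lam) := by
  ext j
  rcases j with _ | j
  · rw [prod_coeff_zero, coeff_add, tailPoly_coeff_zero]
    simp
  · by_cases hj : j < m
    · rw [coeff_add, tailPoly_coeff_succ m _ ⟨j, hj⟩, coeff_prod_one_add]
      simp [symPoly, coeff_one]
    · rw [coeff_eq_zero_of_natDegree_lt ((prod_natDegree m lam).trans_lt (by omega)),
        coeff_add, coeff_eq_zero_of_natDegree_lt ((tailPoly_natDegree m _).trans_lt (by omega))]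
      simp [coeff_one]

open Polynomial in
/-- The linear part: multiplication by a fixed polynomial. -/
noncomputable def mulTail (n m : ℕ) (Q : ℂ[X]) : (Fin m → ℂ) →ₗ[ℂ] (Fin n → ℂ) where
  toFun w := fun j => (Q * tailPoly m w).coeff ((j : ℕ) + 1)
  map_add' v w := by ext; simp [mul_add]
  map_smul' c w := by ext; simp

open Polynomial in
theorem mulTail_injective (n k m : ℕ) (h : k + m = n) (Q : ℂ[X]) (hQ : Q ≠ 0)
    (hd : Q.natDegree ≤ k) : Function.Injective (mulTail n m Q) := by
  rw [← LinearMap.ker_eq_bot, LinearMap.ker_eq_bot']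
  intro w hw
  have h0 : Q * tailPoly m w = 0 := by
    ext j
    rcases j with _ | j
    · simp [mul_coeff_zero, tailPoly_coeff_zero]
    · by_cases hj : j < n
      · simpa [mulTail] using congrFun hw ⟨j, hj⟩
      · have := tailPoly_natDegree m w
        rw [coeff_eq_zero_of_natDegree_lt (natDegree_mul_le.trans_lt (by omega))]
        simp
  have h1 := (mul_eq_zero.mp h0).resolve_left hQ
  ext i
  rw [← tailPoly_coeff_succ m w i, h1]
  simp

open Polynomial in
theorem symPoly_append (n k : ℕ) (hkn : k ≤ n) (μ : Fin k → ℂ) (lam : Fin (n - k) → ℂ) :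
    symPoly n (fun i => Fin.append μ lam (Fin.cast (Nat.add_sub_cancel' hkn).symm i)) =
      mulTail n (n - k) (∏ i, (1 + C (μ i) * X)) (symPoly (n - k) lam) +
        fun j : Fin n => (∏ i, (1 + C (μ i) * X) : ℂ[X]).coeff ((j : ℕ) + 1) := by
  ext j
  have h : (∏ i : Fin n, (1 + C (Fin.append μ lam
      (Fin.cast (Nat.add_sub_cancel' hkn).symm i)) * X)) =
      (∏ i, (1 + C (μ i) * X)) * ∏ i, (1 + C (lam i) * X) := by
    refine (Fintype.prod_equiv (finCongr (Nat.add_sub_cancel' hkn).symm) _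
      (fun i => 1 + C (Fin.append μ lam i) * X) (fun i => rfl)).trans ?_
    rw [Fin.prod_univ_add]
    simp
  have h2 := congrArg (fun P => P.coeff ((j : ℕ) + 1)) h
  beta_reduce at h2
  rw [coeff_prod_one_add, prod_eq_tail (n - k), mul_add, mul_one, coeff_add] at h2
  exact h2.trans (add_comm _ _)

/-- For `μ_1, …, μ_k ∈ ℂ` with `1 ≤ k ≤ n`, the set
`H(μ_1,…,μ_k) = {π_n(μ_1,…,μ_k,λ_1,…,λ_{n-k}) : λ ∈ ℂ^{n-k}}` is an
`(n-k)`-dimensional complex affine subspace of `ℂ^n`. -/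
theorem symPoly_partial_fiber_affine (n k : ℕ) (hk : 1 ≤ k) (hkn : k ≤ n)
    (μ : Fin k → ℂ) :
    ∃ p : AffineSubspace ℂ (Fin n → ℂ),
      (p : Set (Fin n → ℂ)) =
        {v | ∃ lam : Fin (n - k) → ℂ,
          v = symPoly n (fun i =>
            Fin.append μ lam (Fin.cast (Nat.add_sub_cancel' hkn).symm i))} ∧
      Module.finrank ℂ p.direction = n - k := by
  classical
  set Q : Polynomial ℂ := ∏ i, (1 + Polynomial.C (μ i) * Polynomial.X) with hQ
  set v0 : Fin n → ℂ := fun j => Q.coeff ((j : ℕ) + 1) with hv0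
  have hQ0 : Q ≠ 0 := by
    intro h
    have := prod_coeff_zero k μ
    rw [← hQ, h] at this
    simp at this
  refine ⟨AffineSubspace.mk' v0 (LinearMap.range (mulTail n (n - k) Q)), ?_, ?_⟩
  · ext v
    simp only [SetLike.mem_coe, AffineSubspace.mem_mk', LinearMap.mem_range, vsub_eq_sub,
      Set.mem_ofPred_eq]
    have key : ∀ lam, symPoly n (fun i =>
        Fin.append μ lam (Fin.cast (Nat.add_sub_cancel' hkn).symm i)) =
        mulTail n (n - k) Q (symPoly (n - k) lam) + v0 := symPoly_append n k hkn μ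
    constructor
    · rintro ⟨w, hw⟩
      obtain ⟨lam, hl⟩ := exists_factor (n - k) (1 + tailPoly (n - k) w)
        (by simp [tailPoly_coeff_zero])
        ((Polynomial.natDegree_add_le _ _).trans (by simpa using tailPoly_natDegree _ w))
      refine ⟨lam, ?_⟩
      rw [prod_eq_tail] at hl
      have hl' := add_left_cancel hl
      have : symPoly (n - k) lam = w := by
        ext i
        rw [← tailPoly_coeff_succ _ w i, hl', tailPoly_coeff_succ]
      rw [key, this, hw, sub_add_cancel]
    · rintro ⟨lam, rfl⟩
      exact ⟨symPoly (n - k) lam, by rw [key, add_sub_cancel_right]⟩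
  · rw [AffineSubspace.direction_mk', LinearMap.finrank_range_of_inj
      (mulTail_injective n k (n - k) (Nat.add_sub_cancel' hkn) Q hQ0 (prod_natDegree k μ))]
    simp
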